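/- Let $f:\mathbb{R}^n\to\mathbb{R}$ be a polynomial function and let $K$ be a finite subset of $f(\mathbb{R}^n)\setminus K_0(f)$, where $K_0(f)$ is the set of critical values of $f$. Then the set $A_K$ of points $a\in\mathbb{R}^n$ such that for each $\lambda\in K$ there is an open interval $I_\lambda\ni\lambda$ for which the function $x\mapsto\|x-a\|^2$ restricted to $f^{-1}(t)$ is a Morse function (has only non-degenerate critical points) for every $t\in I_\lambda\setminus\{\lambda\}$, is dense in $\mathbb{R}^n$. -/

import Mathlib

open scoped RealInnerProductSpace

/-- `f : ℝⁿ → ℝ` is a polynomial function. -/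
def IsPolyFun {n : ℕ} (f : EuclideanSpace ℝ (Fin n) → ℝ) : Prop :=
  ∃ p : MvPolynomial (Fin n) ℝ, ∀ x, f x = MvPolynomial.eval (fun i => x i) p

/-- The squared distance function `x ↦ ‖x - a‖²`. -/
noncomputable def sqDist {n : ℕ} (a : EuclideanSpace ℝ (Fin n)) :
    EuclideanSpace ℝ (Fin n) → ℝ :=
  fun x => ‖x - a‖ ^ 2

/-- `p` is a non-degenerate critical point of the restriction of `g` to the level set
`h⁻¹(h p)` (at a point where the level set is regular, criticality is the Lagrange
condition `∇g p = μ • ∇h p`, and non-degeneracy means that the bilinear form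
`Hess(g - μ h)` restricted to the tangent space `(∇h p)^⊥` is non-degenerate). -/
def IsNondegenerateCritPtOn {n : ℕ} (h g : EuclideanSpace ℝ (Fin n) → ℝ)
    (p : EuclideanSpace ℝ (Fin n)) : Prop :=
  ∃ μ : ℝ, gradient g p = μ • gradient h p ∧
    ∀ w : EuclideanSpace ℝ (Fin n), w ≠ 0 → ⟪gradient h p, w⟫ = 0 →
      ∃ w' : EuclideanSpace ℝ (Fin n), ⟪gradient h p, w'⟫ = 0 ∧
        iteratedFDeriv ℝ 2 (fun x => g x - μ * h x) p ![w, w'] ≠ 0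

open MvPolynomial in
/-- If `J ≠ 0` and `G` is a family of at least as many polynomials as there are variables, then some
nonzero polynomial in `G` is a multiple of `J`. -/
theorem MvPolynomial.exists_ne_zero_dvd_aeval {k σ τ : Type} [Field k] [Fintype σ] [Fintype τ]
    (hcard : Fintype.card σ ≤ Fintype.card τ) (G : τ → MvPolynomial σ k) {J : MvPolynomial σ k}
    (hJ : J ≠ 0) : ∃ Q : MvPolynomial τ k, Q ≠ 0 ∧ J ∣ aeval G Q := by
  have hdep : ¬ AlgebraicIndependent k (fun o : Option τ => o.elim J G) := by
    intro h
    have h1 := h.cardinalMk_le_trdeg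
    rw [MvPolynomial.trdeg_of_isDomain] at h1
    simp only [Cardinal.mk_fintype, Fintype.card_option, Cardinal.lift_natCast,
      Nat.cast_le] at h1
    omega
  rw [algebraicIndependent_iff] at hdep
  push Not at hdep
  obtain ⟨R, hR, hR0⟩ := hdep
  have key : ∀ R : MvPolynomial (Option τ) k,
      aeval (fun o : Option τ => o.elim J G) R =
        (optionEquivLeft k τ R).eval₂ (aeval G : MvPolynomial τ k →ₐ[k] MvPolynomial σ k) J := by
    intro R
    induction R using MvPolynomial.induction_on with
    | C a => simp [optionEquivLeft_C]
    | add p q hp hq => simp only [map_add, hp, hq, Polynomial.eval₂_add]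
    | mul_X p i hp =>
      rw [map_mul, hp, map_mul, Polynomial.eval₂_mul]
      cases i <;> simp
  rw [key] at hR
  have hr0 : optionEquivLeft k τ R ≠ 0 := by simpa using hR0
  obtain ⟨r, hr, hndvd⟩ :=
    Polynomial.exists_eq_pow_rootMultiplicity_mul_and_not_dvd _ hr0 0
  rw [hr, Polynomial.eval₂_mul, Polynomial.eval₂_pow] at hR
  simp only [map_zero, sub_zero, Polynomial.eval₂_X] at hR hndvd
  have hR' := (mul_eq_zero.mp hR).resolve_left (pow_ne_zero _ hJ)
  refine ⟨r.coeff 0, fun h => hndvd (Polynomial.X_dvd_iff.mpr h), ?_⟩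
  rw [← Polynomial.divX_mul_X_add r] at hR'
  simp only [Polynomial.eval₂_add, Polynomial.eval₂_mul, Polynomial.eval₂_X,
    Polynomial.eval₂_C, RingHom.coe_coe] at hR'
  exact ⟨-Polynomial.eval₂ (aeval G : MvPolynomial τ k →ₐ[k] MvPolynomial σ k) J r.divX, by
    linear_combination hR'⟩

open MvPolynomial in
theorem MvPolynomial.dense_eval_ne_zero {n : ℕ} {q : MvPolynomial (Fin n) ℝ} (hq : q ≠ 0) :
    Dense {a : EuclideanSpace ℝ (Fin n) | eval (fun i => a i) q ≠ 0} := by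
  rw [dense_iff_inter_open]
  intro U hU ⟨x, hx⟩
  by_contra hne
  apply hq
  have hU' : IsOpen ((WithLp.toLp 2 : (Fin n → ℝ) → EuclideanSpace ℝ (Fin n)) ⁻¹' U) :=
    hU.preimage (PiLp.continuous_toLp 2 _)
  obtain ⟨ε, hε, hball⟩ := Metric.isOpen_iff.mp hU' (fun i => x i) hx
  refine funext_set (fun i => Metric.ball (x i) ε) (fun i => ?_) fun y hy => ?_
  · rw [Real.ball_eq_Ioo]
    exact Set.Ioo_infinite (by linarith)
  · by_contra h
    refine hne ⟨WithLp.toLp 2 y, hball ?_, by simpa using h⟩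
    rwa [ball_pi _ hε]

open MvPolynomial in
theorem MvPolynomial.hasFDerivAt_eval {n : ℕ} (p : MvPolynomial (Fin n) ℝ)
    (x : EuclideanSpace ℝ (Fin n)) :
    HasFDerivAt (fun y : EuclideanSpace ℝ (Fin n) => eval (fun i => y i) p)
      (∑ i, eval (fun i => x i) (pderiv i p) •
        (EuclideanSpace.proj i : EuclideanSpace ℝ (Fin n) →L[ℝ] ℝ)) x := by
  induction p using MvPolynomial.induction_on with
  | C a => simpa using hasFDerivAt_const a x
  | add p q hp hq =>
    simp only [map_add, add_smul, Finset.sum_add_distrib]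
    exact hp.add hq
  | mul_X p j hp =>
    simp only [map_mul, eval_X]
    convert! hp.mul (EuclideanSpace.proj j : EuclideanSpace ℝ (Fin n) →L[ℝ] ℝ).hasFDerivAt
      using 1
    ext v
    simp [pderiv_X, Pi.single_apply, apply_ite, add_mul, Finset.sum_add_distrib, Finset.mul_sum,
      mul_assoc]

open MvPolynomial in
/-- The gradient of a polynomial, as a vector of `EuclideanSpace`. -/
noncomputable def MvPolynomial.gradVec {n : ℕ} (p : MvPolynomial (Fin n) ℝ)
    (x : EuclideanSpace ℝ (Fin n)) : EuclideanSpace ℝ (Fin n) :=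
  WithLp.toLp 2 fun i => eval (fun i => x i) (pderiv i p)

open MvPolynomial in
theorem MvPolynomial.gradient_eval {n : ℕ} (p : MvPolynomial (Fin n) ℝ)
    (x : EuclideanSpace ℝ (Fin n)) :
    gradient (fun y : EuclideanSpace ℝ (Fin n) => eval (fun i => y i) p) x = gradVec p x := by
  apply HasGradientAt.gradient
  rw [hasGradientAt_iff_hasFDerivAt]
  convert! hasFDerivAt_eval p x using 1
  ext v
  simp [gradVec, PiLp.inner_apply, mul_comm]

theorem hasFDerivAt_sqDist {n : ℕ} (a x : EuclideanSpace ℝ (Fin n)) :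
    HasFDerivAt (sqDist a) ((2 : ℝ) • innerSL ℝ (x - a)) x := by
  have h := ((hasFDerivAt_id x).sub_const a).norm_sq
  convert! h using 1
  ext v
  simp

theorem gradient_sqDist {n : ℕ} (a x : EuclideanSpace ℝ (Fin n)) :
    gradient (sqDist a) x = (2 : ℝ) • (x - a) := by
  apply HasGradientAt.gradient
  rw [hasGradientAt_iff_hasFDerivAt]
  convert! hasFDerivAt_sqDist a x using 1
  ext v
  simp

open MvPolynomial in
theorem iteratedFDeriv_two_sqDist_sub {n : ℕ} (p : MvPolynomial (Fin n) ℝ) (μ : ℝ)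
    (a x w w' : EuclideanSpace ℝ (Fin n)) :
    iteratedFDeriv ℝ 2 (fun y => sqDist a y - μ * eval (fun i => y i) p) x ![w, w'] =
      2 * ⟪w, w'⟫ -
        μ * ∑ i, (∑ j, eval (fun i => x i) (pderiv j (pderiv i p)) * w j) * w' i := by
  have h1 : fderiv ℝ (fun y => sqDist a y - μ * eval (fun i => y i) p) =
      fun y => (2 : ℝ) • innerSL ℝ (y - a) - μ • ∑ i, eval (fun i => y i) (pderiv i p) •
        (EuclideanSpace.proj i : EuclideanSpace ℝ (Fin n) →L[ℝ] ℝ) := by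
    funext y
    exact ((hasFDerivAt_sqDist a y).sub ((hasFDerivAt_eval p y).const_mul μ)).fderiv
  have h2 := (((innerSL ℝ (E := EuclideanSpace ℝ (Fin n))).hasFDerivAt.comp x
    ((hasFDerivAt_id x).sub_const a)).const_smul (2 : ℝ)).sub
    ((HasFDerivAt.fun_sum (u := Finset.univ) fun i _ =>
      (hasFDerivAt_eval (pderiv i p) x).smul_const
        (EuclideanSpace.proj i : EuclideanSpace ℝ (Fin n) →L[ℝ] ℝ)).const_smul μ)
  rw [iteratedFDeriv_two_apply, h1]
  erw [h2.fderiv]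
  simp
  rw [innerSL_apply_apply]

open MvPolynomial in
/-- The Jacobian matrix, up to a permutation of the rows, of the map
`(x, s) ↦ (x + s • ∇p x, p x)`, with polynomial entries. -/
noncomputable def MvPolynomial.normalJacobian {n : ℕ} (p : MvPolynomial (Fin n) ℝ) :
    Matrix (Fin n ⊕ Unit) (Fin n ⊕ Unit) (MvPolynomial (Fin n ⊕ Unit) ℝ) :=
  Matrix.fromBlocks
    (1 + (X (Sum.inr ()) : MvPolynomial (Fin n ⊕ Unit) ℝ) •
      Matrix.of fun i j => rename Sum.inl (pderiv j (pderiv i p)))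
    (Matrix.of fun i _ => rename Sum.inl (pderiv i p))
    (Matrix.of fun _ i => rename Sum.inl (pderiv i p)) 0

open MvPolynomial in
theorem MvPolynomial.eval_det_normalJacobian {n : ℕ} (p : MvPolynomial (Fin n) ℝ)
    (x : EuclideanSpace ℝ (Fin n)) (s : ℝ) :
    eval (Sum.elim (fun i => x i) fun _ => s) (normalJacobian p).det =
      (Matrix.fromBlocks
        (1 + s • Matrix.of fun i j => eval (fun i => x i) (pderiv j (pderiv i p)))
        (Matrix.of fun i (_ : Unit) => gradVec p x i)
        (Matrix.of fun (_ : Unit) i => gradVec p x i) 0).det := by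
  rw [RingHom.map_det]
  congr 1
  ext (i | i) (j | j) <;>
    simp [normalJacobian, gradVec, eval_rename, Matrix.one_apply, apply_ite, Function.comp_def]

open MvPolynomial in
theorem MvPolynomial.det_normalJacobian_ne_zero {n : ℕ} {p : MvPolynomial (Fin n) ℝ}
    {x : EuclideanSpace ℝ (Fin n)} (hx : gradVec p x ≠ 0) : (normalJacobian p).det ≠ 0 := by
  intro h
  have h0 := eval_det_normalJacobian p x 0
  rw [h, map_zero, zero_smul, add_zero, Matrix.det_fromBlocks_one₁₁, Matrix.det_unique] at h0
  apply hx
  rw [← norm_eq_zero, ← sq_eq_zero_iff, EuclideanSpace.real_norm_sq_eq]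
  simp only [Matrix.sub_apply, Matrix.mul_apply, Matrix.zero_apply, Matrix.of_apply] at h0
  simp only [pow_two]
  linarith

open MvPolynomial in
/-- Over a generic centre, a normal vector at which the Jacobian degenerates occurs only over
finitely many values of `p`. -/
theorem MvPolynomial.exists_generic_center {n : ℕ} {p : MvPolynomial (Fin n) ℝ}
    {x₀ : EuclideanSpace ℝ (Fin n)} (hx₀ : gradVec p x₀ ≠ 0) :
    ∃ q : MvPolynomial (Fin n) ℝ, q ≠ 0 ∧ ∀ a : EuclideanSpace ℝ (Fin n),
      eval (fun i => a i) q ≠ 0 → {t : ℝ | ∃ x s, a = x + s • gradVec p x ∧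
        eval (fun i => x i) p = t ∧
        eval (Sum.elim (fun i => x i) fun _ => s) (normalJacobian p).det = 0}.Finite := by
  obtain ⟨Q, hQ, hdvd⟩ := exists_ne_zero_dvd_aeval (σ := Fin n ⊕ Unit) (τ := Option (Fin n))
    (by simp) (fun o => o.elim (rename Sum.inl p)
      fun i => X (Sum.inl i) + X (Sum.inr ()) * rename Sum.inl (pderiv i p))
    (det_normalJacobian_ne_zero hx₀)
  refine ⟨(optionEquivLeft ℝ (Fin n) Q).leadingCoeff, by simpa using hQ, fun a ha => ?_⟩
  have hmap : (optionEquivLeft ℝ (Fin n) Q).map (eval fun i => a i) ≠ 0 := fun h =>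
    ha (by simpa only [Polynomial.coeff_map, Polynomial.coeff_natDegree, Polynomial.coeff_zero]
      using congrArg (Polynomial.coeff · (optionEquivLeft ℝ (Fin n) Q).natDegree) h)
  refine (Polynomial.finite_setOfPred_isRoot hmap).subset ?_
  rintro t ⟨x, s, hax, rfl, hdet⟩
  have h0 := map_dvd (eval (Sum.elim (fun i => x i) fun _ => s)) hdvd
  rw [hdet, zero_dvd_iff] at h0
  rw [Set.mem_ofPred_eq, Polynomial.IsRoot.def, ← optionEquivLeft_elim_eval, ← h0]
  refine Eq.trans ?_ (eval₂Hom_bind₁ (RingHom.id ℝ) _ _ Q).symm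
  refine congrArg (fun g : Option (Fin n) → ℝ => eval g Q) ?_
  funext o
  cases o <;> simp [hax, gradVec, eval₂_rename, Function.comp_def]

open MvPolynomial in
/-- A critical point of the squared distance that is not a degeneracy of the Jacobian
is non-degenerate. -/
theorem MvPolynomial.isNondegenerateCritPtOn_sqDist {n : ℕ} {p : MvPolynomial (Fin n) ℝ}
    {a x : EuclideanSpace ℝ (Fin n)} {s : ℝ} (ha : a = x + s • gradVec p x)
    (hdet : gradVec p x ≠ 0 →
      eval (Sum.elim (fun i => x i) fun _ => s) (normalJacobian p).det ≠ 0) :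
    IsNondegenerateCritPtOn (fun y => eval (fun i => y i) p) (sqDist a) x := by
  unfold IsNondegenerateCritPtOn
  simp only [gradient_eval, gradient_sqDist, iteratedFDeriv_two_sqDist_sub]
  by_cases hv : gradVec p x = 0
  · refine ⟨0, by simp [ha, hv], fun w hw _ => ⟨w, by simp [hv], ?_⟩⟩
    simpa using hw
  refine ⟨-2 * s, by rw [ha]; module, fun w hw hwv => ?_⟩
  by_contra! hdeg
  apply hdet hv
  rw [eval_det_normalJacobian, ← Matrix.exists_mulVec_eq_zero_iff]
  set v := gradVec p x with hv_def
  set u : EuclideanSpace ℝ (Fin n) := WithLp.toLp 2 fun i =>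
    w i + s * ∑ j, eval (fun i => x i) (pderiv j (pderiv i p)) * w j with hu
  have horth : ∀ w', ⟪v, w'⟫ = 0 → ⟪u, w'⟫ = 0 := fun w' hw' => by
    have h := hdeg w' hw'
    have h2 : ⟪u, w'⟫ = ⟪w, w'⟫ +
        s * ∑ i, (∑ j, eval (fun i => x i) (pderiv j (pderiv i p)) * w j) * w' i := by
      simp only [hu, PiLp.inner_apply, RCLike.inner_apply, conj_trivial, Finset.mul_sum,
        ← Finset.sum_add_distrib]
      refine Finset.sum_congr rfl fun i _ => ?_
      simp only [← Finset.mul_sum]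
      ring
    linarith
  have hmem : u ∈ (ℝ ∙ v)ᗮᗮ := by
    rw [Submodule.mem_orthogonal']
    exact fun w' hw' => horth w' (Submodule.mem_orthogonal_singleton_iff_inner_right.mp hw')
  rw [Submodule.orthogonal_orthogonal, Submodule.mem_span_singleton] at hmem
  obtain ⟨c, hc⟩ := hmem
  refine ⟨Sum.elim (fun i => w i) fun _ => -c, fun h => hw ?_, ?_⟩
  · ext i
    exact congrFun h (Sum.inl i)
  · ext (i | i)
    · have hi := congrArg (fun z : EuclideanSpace ℝ (Fin n) => z i) hc
      simp only [hu, PiLp.smul_apply, smul_eq_mul] at hi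
      simp [Matrix.mulVec, dotProduct, Matrix.one_apply, add_mul, Finset.sum_add_distrib,
        mul_assoc, ← Finset.mul_sum]
      linarith
    · simpa [Matrix.mulVec, dotProduct, PiLp.inner_apply, mul_comm] using hwv

theorem Set.Finite.exists_forall_notMem_of_abs_sub_lt {T : Set ℝ} (hT : T.Finite) (l : ℝ) :
    ∃ ε > 0, ∀ t, t ≠ l → |t - l| < ε → t ∉ T := by
  have h : (T \ {l})ᶜ ∈ nhds l := hT.sdiff.isClosed.isOpen_compl.mem_nhds (by simp)
  obtain ⟨ε, hε, hb⟩ := Metric.mem_nhds_iff.mp h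
  exact ⟨ε, hε, fun t htl ht hT => hb (by simpa [Real.dist_eq] using ht) ⟨hT, htl⟩⟩

/-- for a polynomial `f : ℝⁿ → ℝ` and a finite set `K ⊆ f(ℝⁿ) ∖ K₀(f)` of
regular values, the set of centers `a` such that for every `λ ∈ K` there is an open
interval around `λ` on which (for `t ≠ λ`) the squared distance function `x ↦ ‖x - a‖²`
restricted to `f⁻¹(t)` has only non-degenerate critical points, is dense in `ℝⁿ`. -/
theorem stmt2 {n : ℕ} (f : EuclideanSpace ℝ (Fin n) → ℝ) (hf : IsPolyFun f)
    (K : Set ℝ) (hKfin : K.Finite)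
    (hK : K ⊆ (f '' Set.univ) \ (f '' {x | gradient f x = 0})) :
    Dense {a : EuclideanSpace ℝ (Fin n) | ∀ l ∈ K, ∃ ε > (0:ℝ), ∀ t : ℝ,
      t ≠ l → |t - l| < ε → ∀ p, f p = t →
        (∃ μ : ℝ, gradient (sqDist a) p = μ • gradient f p) →
        IsNondegenerateCritPtOn f (sqDist a) p} := by
  obtain ⟨P, hP⟩ := hf
  obtain rfl : f = fun x => MvPolynomial.eval (fun i => x i) P := funext hP
  simp only [MvPolynomial.gradient_eval, gradient_sqDist] at hK ⊢
  obtain rfl | ⟨l₀, hl₀⟩ := K.eq_empty_or_nonempty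
  · simp
  obtain ⟨⟨x₀, -, hx₀⟩, hreg⟩ := hK hl₀
  obtain ⟨q, hq, hfin⟩ := MvPolynomial.exists_generic_center (p := P) (x₀ := x₀)
    fun h => hreg ⟨x₀, h, hx₀⟩
  refine (MvPolynomial.dense_eval_ne_zero hq).mono fun a ha l _ => ?_
  obtain ⟨ε, hε, hT⟩ := (hfin a ha).exists_forall_notMem_of_abs_sub_lt l
  refine ⟨ε, hε, fun t htl ht x hxt ⟨μ, hμ⟩ => ?_⟩
  have hax : a = x + (-(μ / 2)) • MvPolynomial.gradVec P x := by
    have : x - a = (1 / 2 : ℝ) • μ • MvPolynomial.gradVec P x := by rw [← hμ]; module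
    rw [← sub_sub_self x a, this]
    module
  exact MvPolynomial.isNondegenerateCritPtOn_sqDist hax fun _ hdet =>
    hT t htl ht ⟨x, _, hax, hxt, hdet⟩
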